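/- Let p be a prime. For every integer n > p, the sequence λ_p satisfies the meta-Fibonacci recurrence λ_p(n) = Σ_{i=1}^{p} λ_p(n − i + 1 − λ_p(n − i)). -/

import Mathlib

/-- The row space of a matrix over `ZMod p`: all linear combinations of its rows. -/
def rowSpace {p m n : ℕ} (M : Matrix (Fin m) (Fin n) (ZMod p)) :
    Submodule (ZMod p) (Fin n → ZMod p) :=
  Submodule.span (ZMod p) {v | ∃ i, v = M i}

/-- The capacity of a matrix: the maximal Hamming weight of a vector in its row space. -/
noncomputable def capacity {p m n : ℕ} (M : Matrix (Fin m) (Fin n) (ZMod p)) : ℕ :=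
  sSup (hammingNorm '' (rowSpace M : Set (Fin n → ZMod p)))

/-- `lambdaP p n` is the minimum capacity over all matrices over `𝔽_p`
with `n` columns, none of which is a zero column.  (For `n = 0` this gives `0`.) -/
noncomputable def lambdaP (p n : ℕ) : ℕ :=
  sInf {c | ∃ (m : ℕ) (M : Matrix (Fin m) (Fin n) (ZMod p)),
    (∀ j, ∃ i, M i j ≠ 0) ∧ c = capacity M}

/-- `sigmaP p k = 1 + p + ⋯ + p^k`. -/
def sigmaP (p k : ℕ) : ℕ := ∑ j ∈ Finset.range (k + 1), p ^ j

/-- `lenF p w = w + ⌊w/p⌋ + ⌊w/p²⌋ + ⋯`. -/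
def lenF (p w : ℕ) : ℕ :=
  if h : w = 0 ∨ p < 2 then 0 else w + lenF p (w / p)
termination_by w
decreasing_by exact Nat.div_lt_self (by omega) (by omega)

lemma lenF_zero (p : ℕ) : lenF p 0 = 0 := by rw [lenF]; simp

lemma lenF_eq {p : ℕ} (hp : 2 ≤ p) (w : ℕ) : lenF p w = w + lenF p (w / p) := by
  rcases Nat.eq_zero_or_pos w with rfl | h
  · simp [lenF_zero]
  · rw [lenF, dif_neg (by omega)]

lemma lenF_mono {p : ℕ} (hp : 2 ≤ p) : Monotone (lenF p) := by
  intro v w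
  induction w using Nat.strong_induction_on generalizing v with
  | _ w ih =>
    intro hvw
    rcases Nat.eq_zero_or_pos w with rfl | h
    · have : v = 0 := by omega
      rw [this]
    · rw [lenF_eq hp v, lenF_eq hp w]
      have := ih (w / p) (Nat.div_lt_self h (by omega)) (Nat.div_le_div_right hvw)
      omega

lemma lenF_strictMono {p : ℕ} (hp : 2 ≤ p) : StrictMono (lenF p) := by
  intro v w h
  rw [lenF_eq hp v, lenF_eq hp w]
  have := lenF_mono hp (Nat.div_le_div_right (c := p) h.le)
  omega

lemma lenF_mul_add {p : ℕ} (hp : 2 ≤ p) (u j : ℕ) (hj : j < p) :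
    lenF p (p * u + j) = p * u + j + lenF p u := by
  rw [lenF_eq hp, Nat.mul_add_div (by omega), Nat.div_eq_of_lt hj, add_zero]

lemma le_lenF {p : ℕ} (hp : 2 ≤ p) (w : ℕ) : w ≤ lenF p w := by
  rw [lenF_eq hp]; omega

lemma arith_step {p : ℕ} (hp : 2 ≤ p) (L : ℕ → ℕ)
    (hL : ∀ n w, L n ≤ w ↔ n ≤ lenF p w) (m u : ℕ) :
    L (m + 1 - L m) ≤ u ↔ L (m + 1) ≤ p * u := by
  rw [hL, hL]
  have hF := lenF_mul_add hp u 0 (by omega)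
  simp only [add_zero] at hF
  rw [hF]
  have h1 : L m ≤ m := (hL _ _).2 (le_lenF hp m)
  have h2 : m ≤ lenF p (L m) := (hL _ _).1 le_rfl
  rcases lt_trichotomy (L m) (p * u) with h | h | h
  · rw [lenF_eq hp] at h2
    have h3 : L m / p < u := by
      rw [Nat.div_lt_iff_lt_mul (by omega)]; rwa [mul_comm]
    have := lenF_strictMono hp h3
    omega
  · omega
  · have h3 : lenF p (L m - 1) < m := by
      by_contra hc
      have := (hL m (L m - 1)).2 (by omega)
      omega
    rw [lenF_eq hp] at h3
    have h4 : u ≤ (L m - 1) / p := by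
      rw [Nat.le_div_iff_mul_le (by omega), mul_comm]; omega
    have := lenF_mono hp h4
    omega

lemma sum_hermite {p : ℕ} (hp : 2 ≤ p) (w : ℕ) :
    ∑ j ∈ Finset.range p, (w + j) / p = w := by
  induction w with
  | zero =>
    apply Finset.sum_eq_zero
    intro j hj
    rw [zero_add]
    exact Nat.div_eq_of_lt (Finset.mem_range.1 hj)
  | succ w ih =>
    have h1 := Finset.sum_range_succ (fun j => (w + j) / p) p
    have h2 := Finset.sum_range_succ' (fun j => (w + j) / p) p
    have h3 : (w + p) / p = w / p + 1 := Nat.add_div_right _ (by omega)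
    have h4 : ∑ j ∈ Finset.range p, (w + 1 + j) / p
        = ∑ j ∈ Finset.range p, (w + (j + 1)) / p := by
      apply Finset.sum_congr rfl; intro j _; congr 1; omega
    simp only [add_zero] at h2
    omega

lemma arith_main {p : ℕ} (hp : 2 ≤ p) (L : ℕ → ℕ)
    (hL : ∀ n w, L n ≤ w ↔ n ≤ lenF p w) (n : ℕ) (hn : p < n) :
    L n = ∑ i ∈ Finset.Icc 1 p, L (n - i + 1 - L (n - i)) := by
  have key : ∀ i ∈ Finset.Icc 1 p, L (n - i + 1 - L (n - i)) = (L n + (p - i)) / p := by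
    intro i hi
    rw [Finset.mem_Icc] at hi
    apply eq_of_forall_ge_iff
    intro u
    rw [arith_step hp L hL, ← Nat.lt_add_one_iff, Nat.lt_add_one_iff,
      ← Nat.lt_add_one_iff (m := (L n + (p - i)) / p), Nat.div_lt_iff_lt_mul (by omega)]
    have h1 := hL (n - i + 1) (p * u)
    have h2 := hL n (p * u + (i - 1))
    have h3 := lenF_mul_add hp u (i - 1) (by omega)
    have h4 := lenF_mul_add hp u 0 (by omega)
    simp only [add_zero] at h4
    rw [h4] at h1
    rw [h3] at h2
    have h5 : (u + 1) * p = p * u + p := by ring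
    rw [h5]
    omega
  rw [Finset.sum_congr rfl key]
  conv_lhs => rw [← sum_hermite hp (L n)]
  symm
  apply Finset.sum_bij (fun i _ => p - i)
  · intro i hi; simp at hi ⊢; omega
  · intro i hi j hj h; simp at hi hj; omega
  · intro j hj; simp at hj
    exact ⟨p - j, by simp; omega, by omega⟩
  · intros; rfl

/-- There is a linear code with coordinate set `ι`, without vanishing coordinate,
all of whose words have weight at most `w`. -/
def GoodCode (p : ℕ) (ι : Type) [Fintype ι] (w : ℕ) : Prop :=
  ∃ C : Submodule (ZMod p) (ι → ZMod p), (∀ j, ∃ v ∈ C, v j ≠ 0) ∧ ∀ v ∈ C, hammingNorm v ≤ w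

lemma GoodCode.mono {p : ℕ} {ι : Type} [Fintype ι] {w w' : ℕ} (h : GoodCode p ι w)
    (hw : w ≤ w') : GoodCode p ι w' := by
  obtain ⟨C, h1, h2⟩ := h
  exact ⟨C, h1, fun v hv => (h2 v hv).trans hw⟩

lemma GoodCode.comap {p : ℕ} {ι κ : Type} [Fintype ι] [Fintype κ] {w : ℕ}
    (h : GoodCode p ι w) (f : κ ↪ ι) : GoodCode p κ w := by
  obtain ⟨C, h1, h2⟩ := h
  refine ⟨C.map (LinearMap.funLeft (ZMod p) (ZMod p) f), ?_, ?_⟩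
  · intro j
    obtain ⟨v, hv, hj⟩ := h1 (f j)
    exact ⟨_, Submodule.mem_map_of_mem hv, hj⟩
  · rintro _ ⟨v, hv, rfl⟩
    refine le_trans ?_ (h2 v hv)
    unfold hammingNorm
    apply Finset.card_le_card_of_injOn f
    · intro i hi
      rw [Finset.mem_coe, Finset.mem_filter] at hi ⊢
      exact ⟨Finset.mem_univ _, hi.2⟩
    · exact f.injective.injOn

lemma hammingNorm_eq_sum {p : ℕ} {ι : Type} [Fintype ι] (v : ι → ZMod p) :
    hammingNorm v = ∑ i, if v i ≠ 0 then 1 else 0 := by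
  unfold hammingNorm
  exact Finset.card_filter _ _

lemma GoodCode.sum {p : ℕ} {ι κ : Type} [Fintype ι] [Fintype κ] {w w' : ℕ}
    (h : GoodCode p ι w) (h' : GoodCode p κ w') : GoodCode p (ι ⊕ κ) (w + w') := by
  obtain ⟨C, h1, h2⟩ := h
  obtain ⟨D, h3, h4⟩ := h'
  refine ⟨C.comap (LinearMap.funLeft (ZMod p) (ZMod p) Sum.inl) ⊓
    D.comap (LinearMap.funLeft (ZMod p) (ZMod p) Sum.inr), ?_, ?_⟩
  · rintro (j | j)
    · obtain ⟨v, hv, hj⟩ := h1 j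
      refine ⟨Sum.elim v 0, ⟨?_, ?_⟩, hj⟩
      · exact hv
      · exact D.zero_mem
    · obtain ⟨v, hv, hj⟩ := h3 j
      refine ⟨Sum.elim 0 v, ⟨?_, ?_⟩, hj⟩
      · exact C.zero_mem
      · exact hv
  · rintro v ⟨hv, hv'⟩
    have a := h2 _ hv
    have b := h4 _ hv'
    rw [hammingNorm_eq_sum] at a b ⊢
    rw [Fintype.sum_sum_type]
    exact add_le_add a b

lemma GoodCode.empty (p : ℕ) (ι : Type) [Fintype ι] [IsEmpty ι] : GoodCode p ι 0 :=
  ⟨⊤, fun j => isEmptyElim j, fun v _ => by simp [hammingNorm]⟩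

lemma line_count {p : ℕ} [Fact p.Prime] (a b : ZMod p) (hb : b ≠ 0) :
    (∑ x : ZMod p, if a + x * b ≠ 0 then 1 else 0) = p - 1 := by
  have : (Finset.univ.filter fun x : ZMod p => a + x * b ≠ 0) = Finset.univ.erase (-a / b) := by
    ext x
    simp only [Finset.mem_filter, Finset.mem_univ, true_and, Finset.mem_erase, and_true]
    rw [not_iff_not, eq_div_iff hb, eq_neg_iff_add_eq_zero, add_comm]
  rw [Finset.sum_boole, this, Finset.card_erase_of_mem (Finset.mem_univ _), Finset.card_univ,
    ZMod.card]
  rfl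

lemma GoodCode.lift {p : ℕ} [Fact p.Prime] {ι : Type} [Fintype ι] {w : ℕ}
    (h : GoodCode p ι w) (hw : (p - 1) * Fintype.card ι + 1 = p * w) :
    GoodCode p ((ι × ZMod p) ⊕ Unit) (p * w) := by
  obtain ⟨C, h1, h2⟩ := h
  let φ : ((ι → ZMod p) × ZMod p) →ₗ[ZMod p] ((ι × ZMod p) ⊕ Unit → ZMod p) :=
    { toFun := fun c => Sum.elim (fun ix => c.1 ix.1 + ix.2 * c.2) (fun _ => c.2)
      map_add' := by
        intro c d; ext (i | i)
        · simp; ring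
        · simp
      map_smul' := by
        intro r c; ext (i | i)
        · simp; ring
        · simp }
  refine ⟨(C.prod ⊤).map φ, ?_, ?_⟩
  · rintro (⟨i, x⟩ | i)
    · obtain ⟨v, hv, hj⟩ := h1 i
      refine ⟨φ (v, 0), Submodule.mem_map_of_mem ⟨hv, trivial⟩, ?_⟩
      simpa [φ] using hj
    · refine ⟨φ (0, 1), Submodule.mem_map_of_mem ⟨C.zero_mem, trivial⟩, ?_⟩
      simp [φ]
  · rintro _ ⟨⟨c, a⟩, ⟨hc, -⟩, rfl⟩
    have hc' := h2 c hc
    rw [hammingNorm_eq_sum] at hc' ⊢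
    rw [Fintype.sum_sum_type, Fintype.sum_prod_type]
    by_cases ha : a = 0
    · subst ha
      simp only [φ, LinearMap.coe_mk, AddHom.coe_mk, Sum.elim_inl, Sum.elim_inr, mul_zero,
        add_zero, Finset.sum_const, Finset.card_univ, ZMod.card, smul_eq_mul]
      rw [← Finset.mul_sum]
      simpa using Nat.mul_le_mul_left p hc'
    · have e1 : ∀ i, (∑ x : ZMod p, if φ (c, a) (Sum.inl (i, x)) ≠ 0 then 1 else 0) = p - 1 :=
        fun i => line_count (c i) a ha
      have e2 : (∑ x : Unit, if φ (c, a) (Sum.inr x) ≠ 0 then 1 else 0) ≤ 1 := by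
        rw [Fintype.sum_unique]
        split_ifs <;> omega
      rw [Finset.sum_congr rfl (fun i _ => e1 i), ← hw, Finset.sum_const, Finset.card_univ,
        smul_eq_mul, mul_comm]
      exact Nat.add_le_add_left e2 _

lemma simplex_exists (p : ℕ) [Fact p.Prime] (k : ℕ) :
    ∃ (ι : Type) (_ : Fintype ι), (p - 1) * Fintype.card ι + 1 = p ^ (k + 1) ∧
      GoodCode p ι (p ^ k) := by
  have hp : 2 ≤ p := (Fact.out : p.Prime).two_le
  induction k with
  | zero =>
    refine ⟨Unit, inferInstance, by simp; omega, ⊤, fun _ => ⟨1, trivial, by simp⟩, ?_⟩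
    intro v _
    exact hammingNorm_le_card_fintype
  | succ k ih =>
    obtain ⟨ι, _, h1, h2⟩ := ih
    refine ⟨(ι × ZMod p) ⊕ Unit, inferInstance, ?_, ?_⟩
    · rw [Fintype.card_sum, Fintype.card_prod, ZMod.card, Fintype.card_unit]
      rw [pow_succ, ← h1]
      obtain ⟨q, rfl⟩ : ∃ q, p = q + 1 := ⟨p - 1, by omega⟩
      simp only [Nat.add_sub_cancel]
      ring
    · have := h2.lift (by rw [h1]; ring)
      rwa [← pow_succ'] at this

lemma lenF_pow {p : ℕ} (hp : 2 ≤ p) (k w : ℕ) :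
    (p - 1) * lenF p (p ^ k * w) + p * w = (p - 1) * lenF p w + p ^ (k + 1) * w := by
  induction k with
  | zero => simp
  | succ k ih =>
    have h := lenF_mul_add hp (p ^ k * w) 0 (by omega)
    simp only [add_zero] at h
    rw [show p ^ (k + 1) * w = p * (p ^ k * w) by ring, h]
    obtain ⟨q, rfl⟩ : ∃ q, p = q + 1 := ⟨p - 1, by omega⟩
    simp only [Nat.add_sub_cancel] at ih ⊢
    have e : (q + 1) ^ (k + 1 + 1) * w = q * ((q + 1) * ((q + 1) ^ k * w)) + (q+1)^(k+1) * w := by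
      ring
    rw [e, mul_add]
    omega

lemma repeat_exists {p : ℕ} (ι : Type) [Fintype ι] {w : ℕ} (h : GoodCode p ι w) (r : ℕ) :
    ∃ (κ : Type) (_ : Fintype κ), Fintype.card κ = r * Fintype.card ι ∧ GoodCode p κ (r * w) := by
  induction r with
  | zero => exact ⟨Empty, inferInstance, by simp, by simpa using GoodCode.empty p Empty⟩
  | succ r ih =>
    obtain ⟨κ, _, h1, h2⟩ := ih
    refine ⟨κ ⊕ ι, inferInstance, by rw [Fintype.card_sum, h1]; ring, ?_⟩
    rw [add_mul, one_mul]
    exact h2.sum h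

lemma good_exists (p : ℕ) [Fact p.Prime] (w : ℕ) : ∀ k, 
    ∃ (ι : Type) (_ : Fintype ι), Fintype.card ι = lenF p (p ^ k * w) ∧
      GoodCode p ι (p ^ k * w) := by
  have hp : 2 ≤ p := (Fact.out : p.Prime).two_le
  induction w using Nat.strong_induction_on with
  | _ w ih =>
    intro k
    rcases Nat.eq_zero_or_pos w with rfl | hw
    · exact ⟨Empty, inferInstance, by simp [lenF_zero], by simpa using GoodCode.empty p Empty⟩
    · obtain ⟨ι, _, h1, h2⟩ := ih (w / p) (Nat.div_lt_self hw (by omega)) (k + 1)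
      obtain ⟨κ, _, h3, h4⟩ := simplex_exists p k
      obtain ⟨τ, _, h5, h6⟩ := repeat_exists κ h4 (w % p)
      have hw' : p ^ k * w = p ^ (k + 1) * (w / p) + w % p * p ^ k := by
        conv_lhs => rw [← Nat.div_add_mod w p]
        ring
      refine ⟨ι ⊕ τ, inferInstance, ?_, ?_⟩
      · rw [Fintype.card_sum, h1, h5]
        have e1 := lenF_pow hp k w
        have e2 := lenF_pow hp (k + 1) (w / p)
        have e3 := lenF_eq hp w
        have e4 := Nat.div_add_mod w p
        set q := w / p
        set r := w % p
        set A := lenF p (p ^ k * w)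
        set B := lenF p (p ^ (k + 1) * q)
        obtain ⟨s, rfl⟩ : ∃ s, p = s + 1 := ⟨p - 1, by omega⟩
        simp only [Nat.add_sub_cancel] at e1 e2 h3
        apply Nat.eq_of_mul_eq_mul_left (show 0 < s by omega)
        rw [e3] at e1
        rw [← e4] at e1
        zify at *
        linear_combination e2 - e1 + r * h3
      · rw [hw']
        exact h2.sum h6

lemma goodCode_of_le (p : ℕ) [Fact p.Prime] (n w : ℕ) (h : n ≤ lenF p w) :
    GoodCode p (Fin n) w := by
  obtain ⟨ι, _, h1, h2⟩ := good_exists p w 0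
  simp only [pow_zero, one_mul] at h1 h2
  have : Nonempty (Fin n ↪ ι) := by
    rw [Function.Embedding.nonempty_iff_card_le]; simpa [h1] using h
  exact h2.comap this.some

lemma card_le_of_good (p : ℕ) [Fact p.Prime] (w : ℕ) : ∀ (ι : Type) [Fintype ι],
    GoodCode p ι w → Fintype.card ι ≤ lenF p w := by
  have hp : 2 ≤ p := (Fact.out : p.Prime).two_le
  induction w using Nat.strong_induction_on with
  | _ w ih =>
    intro ι _ hC
    obtain ⟨C, h1, h2⟩ := hC
    rcases Nat.eq_zero_or_pos w with rfl | hw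
    · have : IsEmpty ι := by
        constructor
        intro j
        obtain ⟨v, hv, hj⟩ := h1 j
        have := h2 v hv
        have hv0 : v = 0 := hammingNorm_eq_zero.1 (by omega)
        exact hj (by rw [hv0]; rfl)
      simp
    · obtain ⟨⟨v, hv⟩, hmax⟩ := Finite.exists_max (fun v : C => hammingNorm (v : ι → ZMod p))
      have hres : GoodCode p {i // v i = 0} (w / p) := by
        refine ⟨C.map (LinearMap.funLeft (ZMod p) (ZMod p) Subtype.val), ?_, ?_⟩
        · intro j
          obtain ⟨u, hu, hj⟩ := h1 j
          exact ⟨_, Submodule.mem_map_of_mem hu, hj⟩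
        · rintro _ ⟨u, hu, rfl⟩
          rw [Nat.le_div_iff_mul_le (by omega)]
          refine le_trans ?_ (h2 v hv)
          have hsum : ∑ x : ZMod p, hammingNorm (u + x • v) ≤ p * hammingNorm v := by
            calc _ ≤ ∑ x : ZMod p, hammingNorm v := Finset.sum_le_sum (fun x _ =>
                  hmax ⟨u + x • v, C.add_mem hu (C.smul_mem x hv)⟩)
              _ = _ := by simp
          have hcount : ∑ x : ZMod p, hammingNorm (u + x • v) =
              p * hammingNorm (LinearMap.funLeft (ZMod p) (ZMod p)
                (Subtype.val : {i // v i = 0} → ι) u) + (p - 1) * hammingNorm v := by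
            simp only [hammingNorm_eq_sum]
            rw [Finset.sum_comm]
            have hin : ∀ i, (∑ x : ZMod p, if (u + x • v) i ≠ 0 then 1 else 0) =
                (if v i = 0 then p * (if u i ≠ 0 then 1 else 0) else 0) +
                  (p - 1) * (if v i ≠ 0 then 1 else 0) := by
              intro i
              by_cases hi : v i = 0
              · simp [hi]
              · simp only [Pi.add_apply, Pi.smul_apply, smul_eq_mul]
                rw [line_count _ _ hi]
                simp [hi]
            rw [Finset.sum_congr rfl (fun i _ => hin i), Finset.sum_add_distrib, ← Finset.mul_sum,
              Finset.mul_sum (s := (Finset.univ : Finset {i // v i = 0})), ← Finset.sum_filter]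
            congr 1
            exact Finset.sum_subtype _ (by simp) _
          rw [hcount] at hsum
          obtain ⟨s, hs⟩ : ∃ s, p = s + 1 := ⟨p - 1, by omega⟩
          have e : p * hammingNorm v = (p - 1) * hammingNorm v + hammingNorm v := by
            rw [Nat.sub_mul, one_mul, Nat.sub_add_cancel (Nat.le_mul_of_pos_left _ (by omega))]
          rw [mul_comm]
          omega
      have hle := ih (w / p) (Nat.div_lt_self hw (by omega)) _ hres
      have hcard : Fintype.card ι = Fintype.card {i // v i = 0} + hammingNorm v := by
        rw [Fintype.card_subtype, hammingNorm, ← Finset.card_univ]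
        exact (Finset.card_filter_add_card_filter_not _).symm
      have := h2 v hv
      rw [lenF_eq hp]
      omega

lemma bdd_capacity {p m n : ℕ} (M : Matrix (Fin m) (Fin n) (ZMod p)) :
    BddAbove (hammingNorm '' (rowSpace M : Set (Fin n → ZMod p))) := by
  refine ⟨n, ?_⟩
  rintro _ ⟨v, -, rfl⟩
  simpa using (hammingNorm_le_card_fintype (x := v))

lemma lambdaP_le_iff_good (p : ℕ) [Fact p.Prime] (n w : ℕ) :
    lambdaP p n ≤ w ↔ GoodCode p (Fin n) w := by
  constructor
  · intro h
    have hne : {c | ∃ (m : ℕ) (M : Matrix (Fin m) (Fin n) (ZMod p)),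
        (∀ j, ∃ i, M i j ≠ 0) ∧ c = capacity M}.Nonempty :=
      ⟨_, n, 1, fun j => ⟨j, by simp⟩, rfl⟩
    obtain ⟨m, M, h1, h2⟩ := Nat.sInf_mem hne
    refine ⟨rowSpace M, fun j => ?_, fun v hv => ?_⟩
    · obtain ⟨i, hi⟩ := h1 j
      exact ⟨M i, Submodule.subset_span ⟨i, rfl⟩, hi⟩
    · refine le_trans (le_trans (le_csSup (bdd_capacity M) ⟨v, hv, rfl⟩) (le_of_eq h2.symm)) h
  · rintro ⟨C, h1, h2⟩
    obtain ⟨m, ⟨e⟩⟩ := Finite.exists_equiv_fin C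
    let M : Matrix (Fin m) (Fin n) (ZMod p) := fun i => (e.symm i : Fin n → ZMod p)
    have hle : rowSpace M ≤ C := by
      apply Submodule.span_le.2
      rintro _ ⟨i, rfl⟩
      exact (e.symm i).2
    have hcap : capacity M ≤ w := by
      apply csSup_le
      · exact ⟨_, 0, (rowSpace M).zero_mem, rfl⟩
      · rintro _ ⟨v, hv, rfl⟩
        exact h2 v (hle hv)
    refine le_trans (Nat.sInf_le ⟨m, M, fun j => ?_, rfl⟩) hcap
    obtain ⟨v, hv, hj⟩ := h1 j
    exact ⟨e ⟨v, hv⟩, by simpa [M] using hj⟩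

lemma lambdaP_le_iff (p : ℕ) [Fact p.Prime] (n w : ℕ) :
    lambdaP p n ≤ w ↔ n ≤ lenF p w := by
  rw [lambdaP_le_iff_good]
  exact ⟨fun h => by simpa using card_le_of_good p w _ h, goodCode_of_le p n w⟩

theorem statement7 (p : ℕ) (hp : p.Prime) (n : ℕ) (hn : p < n) :
    lambdaP p n = ∑ i ∈ Finset.Icc 1 p, lambdaP p (n - i + 1 - lambdaP p (n - i)) := by
  have : Fact p.Prime := ⟨hp⟩
  exact arith_main hp.two_le (lambdaP p) (lambdaP_le_iff p) n hn
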